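/- Let M ∈ ℝ^{r×r} be symmetric positive definite, A ∈ ℝ^{p×r}, B ∈ ℝ^{p×s}, μ, ρ > 0, q ∈ ℝʳ, c ∈ ℝᵖ and x' ∈ ℝᵖ. Set E := ((μ/ρ)I_s + BᵀB)⁻¹Bᵀ, G := I_p − BE and S := (M⁻¹ + ρAᵀGA)⁻¹. Then the function (x, w) ↦ (1/2)(M⁻¹x − q)ᵀM(M⁻¹x − q) + (ρ/2)‖x' − Ax − Bw − c‖² + (μ/2)‖w‖² on ℝʳ × ℝˢ has a unique global minimizer (x*, w*), given by x* = Sq + ρSAᵀG(x' − c) and w* = E(x' − Ax* − c). -/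

import Mathlib

open Matrix

section RidgeResidual

variable {m n : Type*} [Fintype m] [Fintype n] [DecidableEq n]

theorem ridge_normal_equation (B : Matrix m n ℝ) {t : ℝ} (ht : 0 < t) :
    (t • (1 : Matrix n n ℝ) + Bᵀ * B) * ((t • (1 : Matrix n n ℝ) + Bᵀ * B)⁻¹ * Bᵀ) = Bᵀ := by
  have hK : (t • (1 : Matrix n n ℝ) + Bᵀ * B).PosDef :=
    (PosDef.one.smul ht).add_posSemidef (by simpa using posSemidef_conjTranspose_mul_self B)
  rw [← Matrix.mul_assoc, mul_nonsing_inv _ ((isUnit_iff_isUnit_det _).mp hK.isUnit),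
    Matrix.one_mul]

theorem transpose_mul_sub_of_normal_equation [DecidableEq m] {B : Matrix m n ℝ} {E : Matrix n m ℝ}
    {t : ℝ} (h : (t • (1 : Matrix n n ℝ) + Bᵀ * B) * E = Bᵀ) : Bᵀ * (1 - B * E) = t • E := by
  rw [Matrix.add_mul, Matrix.smul_mul, Matrix.one_mul, Matrix.mul_assoc] at h
  rw [Matrix.mul_sub, Matrix.mul_one, sub_eq_iff_eq_add, h]

theorem posSemidef_one_sub_of_normal_equation [DecidableEq m] {B : Matrix m n ℝ} {E : Matrix n m ℝ}
    {t : ℝ} (ht : 0 ≤ t) (h : (t • (1 : Matrix n n ℝ) + Bᵀ * B) * E = Bᵀ) :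
    (1 - B * E).PosSemidef := by
  have hG : 1 - B * E = (1 - B * E)ᵀ * (1 - B * E) + t • (Eᵀ * E) := by
    rw [transpose_sub, transpose_mul, transpose_one, Matrix.sub_mul, Matrix.one_mul,
      Matrix.mul_assoc, transpose_mul_sub_of_normal_equation h, Matrix.mul_smul,
      sub_add_cancel]
  rw [hG]
  simp only [← conjTranspose_eq_transpose_of_trivial]
  exact (posSemidef_conjTranspose_mul_self _).add ((posSemidef_conjTranspose_mul_self E).smul ht)

end RidgeResidual

theorem Matrix.IsSymm.quadratic_add {n : Type*} [Fintype n] {M : Matrix n n ℝ}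
    (hM : M.IsSymm) (u d : n → ℝ) :
    (u + d) ⬝ᵥ (M *ᵥ (u + d)) = u ⬝ᵥ (M *ᵥ u) + 2 * (d ⬝ᵥ (M *ᵥ u)) + d ⬝ᵥ (M *ᵥ d) := by
  have h : u ⬝ᵥ (M *ᵥ d) = d ⬝ᵥ (M *ᵥ u) := by
    rw [dotProduct_mulVec, ← mulVec_transpose, hM.eq, dotProduct_comm]
  rw [mulVec_add, add_dotProduct, dotProduct_add, dotProduct_add, h]
  ring

/-- One stage of the FDP recursion: the quadratic
`(x, w) ↦ (1/2)(M⁻¹x − q)ᵀM(M⁻¹x − q) + (ρ/2)‖x' − Ax − Bw − c‖² + (μ/2)‖w‖²`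
has the unique global minimizer `x* = Sq + ρSAᵀG(x' − c)`, `w* = E(x' − Ax* − c)`. -/
theorem stmt_13 (r p s : ℕ) (M : Matrix (Fin r) (Fin r) ℝ) (hM : M.PosDef)
    (A : Matrix (Fin p) (Fin r) ℝ) (B : Matrix (Fin p) (Fin s) ℝ)
    (μ ρ : ℝ) (hμ : 0 < μ) (hρ : 0 < ρ)
    (q : Fin r → ℝ) (c : Fin p → ℝ) (x' : Fin p → ℝ) :
    let E := ((μ / ρ) • (1 : Matrix (Fin s) (Fin s) ℝ) + Bᵀ * B)⁻¹ * Bᵀ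
    let G := (1 : Matrix (Fin p) (Fin p) ℝ) - B * E
    let S := (M⁻¹ + ρ • (Aᵀ * G * A))⁻¹
    let f : (Fin r → ℝ) → (Fin s → ℝ) → ℝ := fun x w =>
      (1 / 2) * ((M⁻¹ *ᵥ x - q) ⬝ᵥ (M *ᵥ (M⁻¹ *ᵥ x - q)))
        + (ρ / 2) * ((x' - A *ᵥ x - B *ᵥ w - c) ⬝ᵥ (x' - A *ᵥ x - B *ᵥ w - c))
        + (μ / 2) * (w ⬝ᵥ w)
    let xstar := S *ᵥ q + ρ • ((S * Aᵀ * G) *ᵥ (x' - c))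
    let wstar := E *ᵥ (x' - A *ᵥ xstar - c)
    ∀ (x : Fin r → ℝ) (w : Fin s → ℝ), (x, w) ≠ (xstar, wstar) →
      f xstar wstar < f x w := by
  intro E G S f xstar wstar x w hne
  have hE := ridge_normal_equation B (div_pos hμ hρ)
  have hG : G.PosSemidef := posSemidef_one_sub_of_normal_equation (div_pos hμ hρ).le hE
  have hBG : Bᵀ * G = (μ / ρ) • E := transpose_mul_sub_of_normal_equation hE
  have hMsymm : M.IsSymm := by simpa [IsHermitian, IsSymm] using hM.isHermitian
  have hMM : M * M⁻¹ = 1 := mul_nonsing_inv _ ((isUnit_iff_isUnit_det _).mp hM.isUnit)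
  have hT : (M⁻¹ + ρ • (Aᵀ * G * A)).PosDef :=
    hM.inv.add_posSemidef
      (by simpa using (hG.conjTranspose_mul_mul_same A).smul hρ.le)
  have hTS : (M⁻¹ + ρ • (Aᵀ * G * A)) * S = 1 :=
    mul_nonsing_inv _ ((isUnit_iff_isUnit_det _).mp hT.isUnit)
  set y := x' - A *ᵥ xstar - c with hy
  have hv : x' - A *ᵥ xstar - B *ᵥ wstar - c = G *ᵥ y := by
    simp only [G, wstar, ← hy, sub_mulVec, one_mulVec, ← mulVec_mulVec]
    rw [hy]; abel
  have hx : M⁻¹ *ᵥ xstar - q = ρ • (Aᵀ *ᵥ (G *ᵥ y)) := by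
    have h : (M⁻¹ + ρ • (Aᵀ * G * A)) *ᵥ xstar = q + ρ • (Aᵀ *ᵥ (G *ᵥ (x' - c))) := by
      simp only [xstar]
      rw [mulVec_add, mulVec_smul, mulVec_mulVec, mulVec_mulVec, Matrix.mul_assoc S,
        ← Matrix.mul_assoc _ S, hTS, one_mulVec, Matrix.one_mul, ← mulVec_mulVec]
    rw [add_mulVec, smul_mulVec, ← mulVec_mulVec, ← mulVec_mulVec] at h
    have hy' : y = (x' - c) - A *ᵥ xstar := by rw [hy]; abel
    rw [hy', mulVec_sub G, mulVec_sub Aᵀ, smul_sub, ← sub_eq_zero]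
    rw [← sub_eq_zero] at h
    rw [← h]; abel
  have hw : μ • wstar = ρ • (Bᵀ *ᵥ (G *ᵥ y)) := by
    rw [mulVec_mulVec, hBG, smul_mulVec, smul_smul, mul_div_cancel₀ _ hρ.ne']
  obtain ⟨d, rfl⟩ : ∃ d, x = xstar + d := ⟨x - xstar, by abel⟩
  obtain ⟨e, rfl⟩ : ∃ e, w = wstar + e := ⟨w - wstar, by abel⟩
  have hres : x' - A *ᵥ (xstar + d) - B *ᵥ (wstar + e) - c = G *ᵥ y - (A *ᵥ d + B *ᵥ e) := by
    rw [← hv, mulVec_add A, mulVec_add B]; abel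
  have hgrad : M⁻¹ *ᵥ (xstar + d) - q = (M⁻¹ *ᵥ xstar - q) + M⁻¹ *ᵥ d := by
    rw [mulVec_add]; abel
  have hlin : (M⁻¹ *ᵥ d) ⬝ᵥ (M *ᵥ (M⁻¹ *ᵥ xstar - q))
      = ρ * ((A *ᵥ d) ⬝ᵥ (G *ᵥ y)) := by
    rw [dotProduct_mulVec, ← mulVec_transpose, hMsymm.eq, mulVec_mulVec, hMM, one_mulVec, hx,
      dotProduct_smul, dotProduct_mulVec, vecMul_transpose, smul_eq_mul]
  have hquad : (M⁻¹ *ᵥ d) ⬝ᵥ (M *ᵥ (M⁻¹ *ᵥ d)) = d ⬝ᵥ (M⁻¹ *ᵥ d) := by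
    rw [mulVec_mulVec, hMM, one_mulVec, dotProduct_comm]
  have hwlin : μ * (e ⬝ᵥ wstar) = ρ * ((B *ᵥ e) ⬝ᵥ (G *ᵥ y)) := by
    rw [← smul_eq_mul, ← dotProduct_smul, hw, dotProduct_smul, dotProduct_mulVec,
      vecMul_transpose, smul_eq_mul]
  have hdiff : f (xstar + d) (wstar + e) = f xstar wstar + (1 / 2) * (d ⬝ᵥ (M⁻¹ *ᵥ d))
      + (ρ / 2) * ((A *ᵥ d + B *ᵥ e) ⬝ᵥ (A *ᵥ d + B *ᵥ e)) + (μ / 2) * (e ⬝ᵥ e) := by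
    simp only [f]
    rw [hres, hgrad, hv, hMsymm.quadratic_add, hlin, hquad]
    simp only [sub_dotProduct, dotProduct_sub, add_dotProduct, dotProduct_add]
    rw [dotProduct_comm (G *ᵥ y) (A *ᵥ d), dotProduct_comm (G *ᵥ y) (B *ᵥ e),
      dotProduct_comm wstar e]
    linear_combination hwlin
  have hnonneg : ∀ {k : ℕ} (v : Fin k → ℝ), 0 ≤ v ⬝ᵥ v := fun v => by
    simpa using dotProduct_star_self_nonneg v
  rw [hdiff]
  have hres_nonneg := mul_nonneg (half_pos hρ).le (hnonneg (A *ᵥ d + B *ᵥ e))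
  by_cases hd : d = 0
  · subst hd
    have he : e ≠ 0 := by
      rintro rfl
      simp at hne
    have hpos : 0 < e ⬝ᵥ e := (hnonneg e).lt_of_ne' (by simpa using he)
    have := mul_pos (half_pos hμ) hpos
    rw [zero_dotProduct]
    linarith
  · have hpos : 0 < d ⬝ᵥ (M⁻¹ *ᵥ d) := by
      simpa using hM.inv.dotProduct_mulVec_pos hd
    have := mul_nonneg (half_pos hμ).le (hnonneg e)
    linarith
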